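/- Let N ≥ 2 and d be positive integers and let ℰ⁽²⁾ be the doubled MPS channel on operators on ℂ^N ⊗ ℂ^N defined by ℰ⁽²⁾(R) := ∫_{U(Nd)} Tr_{d×d}( (U⊗U) (R ⊗ |0_d,0_d⟩⟨0_d,0_d|) (U†⊗U†) ) dμ(U). Set η := (1 − 1/N²)/(d − 1/(N²d)), P'± := P±/Tr(P±), r₁ := (1/(2(N²d+1)))·[ (Nd+1)(N+1) P'₊ + (Nd−1)(N−1) P'₋ ], ℓ₂ := (1/(2(N²d+1)))·[ (Nd−1)(N−1) P₊ − (Nd+1)(N+1) P₋ ], and r₂ := P'₊ − P'₋. Then for every integer n ≥ 1 and every linear operator R on ℂ^N ⊗ ℂ^N, the n-fold composition satisfies (ℰ⁽²⁾)ⁿ(R) = Tr(R) · r₁ + ηⁿ · Tr(ℓ₂ R) · r₂. In particular ℰ⁽²⁾(r₁) = r₁ and ℰ⁽²⁾(r₂) = η · r₂. -/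

import Mathlib

open Matrix MeasureTheory
open scoped Kronecker

noncomputable instance (n : Type*) [Fintype n] [DecidableEq n] :
    MeasurableSpace (Matrix.unitaryGroup n ℂ) := borel _

instance (n : Type*) [Fintype n] [DecidableEq n] :
    BorelSpace (Matrix.unitaryGroup n ℂ) := ⟨rfl⟩

/-- The swap operator on `ℂ^N ⊗ ℂ^N`. -/
def swapOp (N : ℕ) : Matrix (Fin N × Fin N) (Fin N × Fin N) ℂ :=
  fun p q => if p.1 = q.2 ∧ p.2 = q.1 then 1 else 0

/-- Projector onto the symmetric subspace of `ℂ^N ⊗ ℂ^N`. -/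
noncomputable def Pplus (N : ℕ) : Matrix (Fin N × Fin N) (Fin N × Fin N) ℂ :=
  (1 / 2 : ℂ) • ((1 : Matrix (Fin N × Fin N) (Fin N × Fin N) ℂ) + swapOp N)

/-- Projector onto the antisymmetric subspace of `ℂ^N ⊗ ℂ^N`. -/
noncomputable def Pminus (N : ℕ) : Matrix (Fin N × Fin N) (Fin N × Fin N) ℂ :=
  (1 / 2 : ℂ) • ((1 : Matrix (Fin N × Fin N) (Fin N × Fin N) ℂ) - swapOp N)

/-- `R ⊗ |0_d,0_d⟩⟨0_d,0_d|` on `(ℂ^N ⊗ ℂ^d) ⊗ (ℂ^N ⊗ ℂ^d)`. -/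
def attachAux (N d : ℕ) (v : Fin d → ℂ) (R : Matrix (Fin N × Fin N) (Fin N × Fin N) ℂ) :
    Matrix ((Fin N × Fin d) × (Fin N × Fin d)) ((Fin N × Fin d) × (Fin N × Fin d)) ℂ :=
  fun p q =>
    R (p.1.1, p.2.1) (q.1.1, q.2.1) *
      (v p.1.2 * v p.2.2 * (starRingEnd ℂ) (v q.1.2) * (starRingEnd ℂ) (v q.2.2))

/-- The doubled MPS channel `ℰ⁽²⁾`. -/
noncomputable def doubledMPSChannel (N d : ℕ)
    (μ : Measure (Matrix.unitaryGroup (Fin N × Fin d) ℂ)) (v : Fin d → ℂ)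
    (R : Matrix (Fin N × Fin N) (Fin N × Fin N) ℂ) :
    Matrix (Fin N × Fin N) (Fin N × Fin N) ℂ :=
  fun p q => ∫ U, ∑ s₁ : Fin d, ∑ s₂ : Fin d,
    (((U : Matrix (Fin N × Fin d) (Fin N × Fin d) ℂ) ⊗ₖ
        (U : Matrix (Fin N × Fin d) (Fin N × Fin d) ℂ)) *
      attachAux N d v R *
      (((U : Matrix (Fin N × Fin d) (Fin N × Fin d) ℂ))ᴴ ⊗ₖ
        ((U : Matrix (Fin N × Fin d) (Fin N × Fin d) ℂ))ᴴ))
      ((p.1, s₁), (p.2, s₂)) ((q.1, s₁), (q.2, s₂)) ∂μ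

section CommutantTensorSquare

variable {m : Type*} [DecidableEq m]

/-- The derivation-like action `X ⊗ 1 + 1 ⊗ X` of a matrix on the tensor square. -/
def tensorSquareSum : Matrix m m ℂ →ₗ[ℂ] Matrix (m × m) (m × m) ℂ where
  toFun X := X ⊗ₖ (1 : Matrix m m ℂ) + (1 : Matrix m m ℂ) ⊗ₖ X
  map_add' X Y := by
    simp only [add_kronecker, kronecker_add]
    abel
  map_smul' c X := by
    simp [smul_kronecker, kronecker_smul]

theorem tensorSquareSum_apply (X : Matrix m m ℂ) :
    tensorSquareSum X = X ⊗ₖ (1 : Matrix m m ℂ) + (1 : Matrix m m ℂ) ⊗ₖ X := rfl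

variable [Fintype m]

theorem one_add_smul_mem_unitaryGroup {P : Matrix m m ℂ} (hP : P * P = P) (hPH : Pᴴ = P)
    {z : ℂ} (hz : z * starRingEnd ℂ z = 1) :
    1 + (z - 1) • P ∈ unitaryGroup m ℂ := by
  rw [mem_unitaryGroup_iff, star_eq_conjTranspose, conjTranspose_add, conjTranspose_smul, hPH,
    conjTranspose_one]
  have hz' : (z - 1) * starRingEnd ℂ (z - 1) = - (z - 1) - starRingEnd ℂ (z - 1) := by
    simp only [map_sub, map_one]
    linear_combination hz
  simp only [mul_add, add_mul, one_mul, mul_one, smul_mul_smul_comm, hP]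
  change 1 + (z - 1) • P + ((starRingEnd ℂ (z - 1)) • P + ((z - 1) * starRingEnd ℂ (z - 1)) • P) = 1
  rw [hz']
  module

theorem commute_tensorSquareSum_of_proj {M : Matrix (m × m) (m × m) ℂ}
    (hM : ∀ W ∈ unitaryGroup m ℂ, Commute M (W ⊗ₖ W))
    {P : Matrix m m ℂ} (hP : P * P = P) (hPH : Pᴴ = P) : Commute M (tensorSquareSum P) := by
  have key : ∀ z : ℂ, (1 + (z - 1) • P) ⊗ₖ (1 + (z - 1) • P)
      = 1 + (z - 1) • tensorSquareSum P + ((z - 1) * (z - 1)) • (P ⊗ₖ P) := by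
    intro z
    simp only [add_kronecker, kronecker_add, smul_kronecker, kronecker_smul, one_kronecker_one,
      tensorSquareSum_apply]
    module
  have h1 := hM _ (one_add_smul_mem_unitaryGroup hP hPH (z := -1) (by simp))
  have h2 := hM _ (one_add_smul_mem_unitaryGroup hP hPH (z := Complex.I) (by simp))
  rw [key] at h1 h2
  have h3 := ((h1.sub_right (Commute.one_right M)).smul_right (-Complex.I / 2)).add_right
    ((h2.sub_right (Commute.one_right M)).smul_right (-1 : ℂ))
  refine (congrArg (Commute M) ?_).mpr h3
  match_scalars <;> ring_nf
  simp

theorem commute_tensorSquareSum_vecMulVec_star {M : Matrix (m × m) (m × m) ℂ}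
    (hM : ∀ W ∈ unitaryGroup m ℂ, Commute M (W ⊗ₖ W)) (v : m → ℂ) :
    Commute M (tensorSquareSum (vecMulVec v (star v))) := by
  by_cases hv : v = 0
  · simp [hv]
  have hc : star v ⬝ᵥ v ≠ 0 := by
    open ComplexOrder in simpa using dotProduct_star_self_eq_zero.not.mpr hv
  have hcs : star (star v ⬝ᵥ v) = star v ⬝ᵥ v := by
    rw [← star_dotProduct_star, star_star, dotProduct_comm]
  have h := commute_tensorSquareSum_of_proj hM (P := (star v ⬝ᵥ v)⁻¹ • vecMulVec v (star v))
    (by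
      rw [smul_mul_smul_comm, vecMulVec_mul_vecMulVec, vecMulVec_smul, smul_smul]
      congr 1
      field_simp)
    (by rw [conjTranspose_smul, conjTranspose_vecMulVec, star_star, star_inv₀, hcs])
  rw [map_smul] at h
  have h' := h.smul_right (star v ⬝ᵥ v)
  rwa [smul_smul, mul_inv_cancel₀ hc, one_smul] at h'

theorem commute_tensorSquareSum {M : Matrix (m × m) (m × m) ℂ}
    (hM : ∀ W ∈ unitaryGroup m ℂ, Commute M (W ⊗ₖ W)) (X : Matrix m m ℂ) :
    Commute M (tensorSquareSum X) := by
  have polar : ∀ u w : m → ℂ, vecMulVec u (star w) =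
      (1 / 4 : ℂ) • (vecMulVec (u + w) (star (u + w)) - vecMulVec (u - w) (star (u - w))
        + Complex.I • vecMulVec (u + Complex.I • w) (star (u + Complex.I • w))
        - Complex.I • vecMulVec (u - Complex.I • w) (star (u - Complex.I • w))) := by
    intro u w
    ext i j
    simp [vecMulVec_apply]
    ring_nf
    simp
    ring
  have hvec : ∀ u w : m → ℂ, Commute M (tensorSquareSum (vecMulVec u (star w))) := by
    intro u w
    have h := commute_tensorSquareSum_vecMulVec_star hM
    rw [polar]
    simp only [map_smul, map_add, map_sub]
    exact (((h _).sub_right (h _)).add_right ((h _).smul_right _) |>.sub_right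
      ((h _).smul_right _)).smul_right _
  rw [matrix_eq_sum_single X, map_sum]
  refine Commute.sum_right _ _ _ fun i _ => ?_
  rw [map_sum]
  refine Commute.sum_right _ _ _ fun j _ => ?_
  have := (hvec (X i j • Pi.single i 1) (Pi.single j 1))
  refine (congrArg (fun Z => Commute M (tensorSquareSum Z)) ?_).mpr this
  ext a b
  simp [vecMulVec_apply, single_apply, Pi.single_apply]
  grind

theorem commute_kronecker_add_kronecker {M : Matrix (m × m) (m × m) ℂ}
    (hM : ∀ W ∈ unitaryGroup m ℂ, Commute M (W ⊗ₖ W)) (X Y : Matrix m m ℂ) :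
    Commute M (X ⊗ₖ Y + Y ⊗ₖ X) := by
  have h := commute_tensorSquareSum hM
  have e : X ⊗ₖ Y + Y ⊗ₖ X
      = tensorSquareSum X * tensorSquareSum Y - tensorSquareSum (X * Y) := by
    simp only [tensorSquareSum_apply, mul_add, add_mul, ← mul_kronecker_mul, one_mul, mul_one]
    abel
  rw [e]
  exact ((h X).mul_right (h Y)).sub_right (h _)

/-- A matrix commuting with `W ⊗ W` for all unitary `W` is a combination of the identity and
the swap, determined by its two traces. -/
theorem apply_of_commute_kronecker_self {M : Matrix (m × m) (m × m) ℂ}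
    (hM : ∀ W ∈ unitaryGroup m ℂ, Commute M (W ⊗ₖ W)) (b e k l : m) :
    (Fintype.card m : ℂ) * ((Fintype.card m : ℂ) ^ 2 - 1) * M (b, e) (k, l) =
      (Fintype.card m * (∑ i, ∑ j, M (i, j) (i, j)) - ∑ i, ∑ j, M (i, j) (j, i))
          * (if b = k ∧ e = l then 1 else 0)
        + (Fintype.card m * (∑ i, ∑ j, M (i, j) (j, i)) - ∑ i, ∑ j, M (i, j) (i, j))
          * (if e = k ∧ b = l then 1 else 0) := by
  have entry : ∀ b e i j : m, M (b, e) (k, l) + (if i = j then M (e, b) (k, l) else 0) =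
      M (i, j) (i, j) * (if b = k ∧ e = l then 1 else 0)
        + M (i, j) (j, i) * (if e = k ∧ b = l then 1 else 0) := by
    intro b e i j
    have h := congrFun (congrFun
      (commute_kronecker_add_kronecker hM (single i b 1) (single j e 1)).eq (i, j)) (k, l)
    rw [mul_add, add_mul, Matrix.add_apply, Matrix.add_apply] at h
    simp only [single_kronecker_single, mul_one, mul_apply, single_apply, Prod.mk.injEq,
      Fintype.sum_prod_type, ite_and, mul_ite, ite_mul, zero_mul, one_mul, mul_zero,
      Finset.sum_ite_eq, Finset.mem_univ, if_true] at h
    by_cases hij : i = j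
    · subst hij
      simp only [if_true, Finset.sum_ite_irrel, Finset.sum_const_zero, Finset.sum_ite_eq,
        Finset.mem_univ] at h ⊢
      rw [← h]
      simp [ite_and]
    · simp only [hij, Ne.symm hij, if_false, Finset.sum_const_zero, add_zero] at h ⊢
      rw [← h]
      simp [ite_and]
  have total : ∀ b e : m, (Fintype.card m : ℂ) ^ 2 * M (b, e) (k, l)
      + Fintype.card m * M (e, b) (k, l) =
      (∑ i, ∑ j, M (i, j) (i, j)) * (if b = k ∧ e = l then 1 else 0)
        + (∑ i, ∑ j, M (i, j) (j, i)) * (if e = k ∧ b = l then 1 else 0) := by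
    intro b e
    have h := Finset.sum_congr rfl fun i (_ : i ∈ Finset.univ) =>
      Finset.sum_congr rfl fun j (_ : j ∈ Finset.univ) => entry b e i j
    simp only [Finset.sum_add_distrib, ← Finset.sum_mul] at h
    rw [← h]
    simp
    ring
  linear_combination (Fintype.card m : ℂ) * total b e - total e b

end CommutantTensorSquare

section HaarTwirl

variable {m : Type*} [Fintype m] [DecidableEq m] (μ : Measure (unitaryGroup m ℂ))

/-- The average of `A` under conjugation by `U ⊗ U`. -/
noncomputable def haarTwirl (A : Matrix (m × m) (m × m) ℂ) : Matrix (m × m) (m × m) ℂ :=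
  fun p q => ∫ U : unitaryGroup m ℂ, (((U : Matrix m m ℂ) ⊗ₖ (U : Matrix m m ℂ)) * A *
    ((U : Matrix m m ℂ)ᴴ ⊗ₖ (U : Matrix m m ℂ)ᴴ)) p q ∂μ

variable [IsProbabilityMeasure μ]

theorem integrable_conj_kronecker_self (A : Matrix (m × m) (m × m) ℂ) (p q : m × m) :
    Integrable (fun U : unitaryGroup m ℂ => (((U : Matrix m m ℂ) ⊗ₖ (U : Matrix m m ℂ)) * A *
      ((U : Matrix m m ℂ)ᴴ ⊗ₖ (U : Matrix m m ℂ)ᴴ)) p q) μ := by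
  have hcont : ∀ i j, Continuous fun U : unitaryGroup m ℂ => (U : Matrix m m ℂ) i j :=
    fun i j => continuous_subtype_val.matrix_elem i j
  have hbound : ∀ (U : unitaryGroup m ℂ) i j, ‖(U : Matrix m m ℂ) i j‖ ≤ 1 :=
    fun U i j => entry_norm_bound_of_unitary U.2 i j
  simp only [mul_apply, Finset.sum_mul, kroneckerMap_apply, conjTranspose_apply]
  refine integrable_finsetSum _ fun x _ => integrable_finsetSum _ fun y _ => ?_
  refine Integrable.of_bound (C := ‖A y x‖) ?_ (Filter.Eventually.of_forall fun U => ?_)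
  · exact Continuous.aestronglyMeasurable <|
      (((hcont _ _).mul (hcont _ _)).mul continuous_const).mul
        ((hcont _ _).star.mul (hcont _ _).star)
  · simp only [norm_mul, norm_star]
    calc _ ≤ 1 * 1 * ‖A y x‖ * (1 * 1) := by gcongr <;> apply hbound
      _ = ‖A y x‖ := by ring

theorem mul_haarTwirl_mul (L A K : Matrix (m × m) (m × m) ℂ) (p q : m × m) :
    (L * haarTwirl μ A * K) p q = ∫ U : unitaryGroup m ℂ,
      (L * (((U : Matrix m m ℂ) ⊗ₖ (U : Matrix m m ℂ)) * A *
        ((U : Matrix m m ℂ)ᴴ ⊗ₖ (U : Matrix m m ℂ)ᴴ)) * K) p q ∂μ := by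
  have hint := integrable_conj_kronecker_self μ A
  simp only [mul_apply (M := _ * _) (N := K), mul_apply (M := L)]
  rw [integral_finsetSum _ fun x _ =>
    (integrable_finsetSum _ fun y _ => (hint y x).const_mul _).mul_const _]
  refine Finset.sum_congr rfl fun x _ => ?_
  rw [integral_mul_const, integral_finsetSum _ fun y _ => (hint y x).const_mul _]
  simp only [integral_const_mul, haarTwirl]

theorem commute_haarTwirl [μ.IsMulLeftInvariant] (A : Matrix (m × m) (m × m) ℂ)
    {W : Matrix m m ℂ} (hW : W ∈ unitaryGroup m ℂ) : Commute (haarTwirl μ A) (W ⊗ₖ W) := by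
  have hconj : (W ⊗ₖ W) * haarTwirl μ A * (Wᴴ ⊗ₖ Wᴴ) = haarTwirl μ A := by
    ext p q
    rw [mul_haarTwirl_mul]
    refine Eq.trans ?_ (integral_mul_left_eq_self (μ := μ)
      (fun U : unitaryGroup m ℂ => (((U : Matrix m m ℂ) ⊗ₖ (U : Matrix m m ℂ)) * A *
        ((U : Matrix m m ℂ)ᴴ ⊗ₖ (U : Matrix m m ℂ)ᴴ)) p q) ⟨W, hW⟩)
    refine integral_congr_ae (Filter.Eventually.of_forall fun U => ?_)
    simp only [Submonoid.coe_mul, conjTranspose_mul, mul_kronecker_mul, Matrix.mul_assoc]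
  have hunit : (Wᴴ ⊗ₖ Wᴴ) * (W ⊗ₖ W) = 1 := by
    rw [← mul_kronecker_mul, ← star_eq_conjTranspose, mem_unitaryGroup_iff'.mp hW,
      one_kronecker_one]
  calc haarTwirl μ A * (W ⊗ₖ W)
      = (W ⊗ₖ W) * haarTwirl μ A * ((Wᴴ ⊗ₖ Wᴴ) * (W ⊗ₖ W)) := by
        rw [← Matrix.mul_assoc, hconj]
    _ = (W ⊗ₖ W) * haarTwirl μ A := by rw [hunit, Matrix.mul_one]

theorem trace_haarTwirl (A : Matrix (m × m) (m × m) ℂ) : (haarTwirl μ A).trace = A.trace := by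
  simp only [trace, diag_apply, haarTwirl]
  rw [← integral_finsetSum _ fun p _ => integrable_conj_kronecker_self μ A p p]
  have : ∀ U : unitaryGroup m ℂ, ∑ p, (((U : Matrix m m ℂ) ⊗ₖ (U : Matrix m m ℂ)) * A *
      ((U : Matrix m m ℂ)ᴴ ⊗ₖ (U : Matrix m m ℂ)ᴴ)) p p = A.trace := by
    intro U
    change trace _ = _
    rw [trace_mul_comm, ← Matrix.mul_assoc, ← mul_kronecker_mul, ← star_eq_conjTranspose,
      mem_unitaryGroup_iff'.mp U.2, one_kronecker_one, Matrix.one_mul]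
  simp only [this, integral_const, probReal_univ, one_smul]
  rfl

theorem sum_haarTwirl_swap (A : Matrix (m × m) (m × m) ℂ) :
    ∑ p, haarTwirl μ A p p.swap = ∑ p, A p p.swap := by
  simp only [haarTwirl]
  rw [← integral_finsetSum _ fun p _ => integrable_conj_kronecker_self μ A p p.swap]
  have htrace : ∀ M : Matrix (m × m) (m × m) ℂ,
      ∑ p, M p p.swap = (M.submatrix id Prod.swap).trace := fun M => rfl
  have : ∀ U : unitaryGroup m ℂ, ∑ p, (((U : Matrix m m ℂ) ⊗ₖ (U : Matrix m m ℂ)) * A *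
      ((U : Matrix m m ℂ)ᴴ ⊗ₖ (U : Matrix m m ℂ)ᴴ)) p p.swap = ∑ p, A p p.swap := by
    intro U
    set V : Matrix m m ℂ := U.1
    have hV : Vᴴ * V = 1 := mem_unitaryGroup_iff'.mp U.2
    have hswap : (Vᴴ ⊗ₖ Vᴴ).submatrix id Prod.swap = (Vᴴ ⊗ₖ Vᴴ).submatrix Prod.swap id := by
      ext p q
      simp [mul_comm]
    calc _ = ((V ⊗ₖ V) * A * (Vᴴ ⊗ₖ Vᴴ).submatrix id Prod.swap).trace := rfl
      _ = (((Vᴴ ⊗ₖ Vᴴ) * (V ⊗ₖ V)).submatrix Prod.swap id * A).trace := by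
        rw [hswap, trace_mul_comm, ← Matrix.mul_assoc]
        rfl
      _ = ∑ p, A p.swap p := by
        rw [← mul_kronecker_mul, hV, one_kronecker_one]
        simp [trace, mul_apply, one_apply]
      _ = _ := (Equiv.prodComm m m).sum_comp fun p => A p p.swap
  simp only [this, integral_const, probReal_univ, one_smul]

/-- Second-moment formula for the Haar measure on the unitary group. -/
theorem haarTwirl_apply [μ.IsMulLeftInvariant] (A : Matrix (m × m) (m × m) ℂ) (b e k l : m) :
    (Fintype.card m : ℂ) * ((Fintype.card m : ℂ) ^ 2 - 1) * haarTwirl μ A (b, e) (k, l) =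
      (Fintype.card m * A.trace - ∑ p, A p p.swap) * (if b = k ∧ e = l then 1 else 0)
        + (Fintype.card m * (∑ p, A p p.swap) - A.trace)
          * (if e = k ∧ b = l then 1 else 0) := by
  rw [apply_of_commute_kronecker_self (fun W hW => commute_haarTwirl μ A hW),
    ← trace_haarTwirl μ A, ← sum_haarTwirl_swap μ A]
  simp only [trace, diag_apply, Fintype.sum_prod_type, Prod.swap_prod_mk]

end HaarTwirl

theorem trace_swapOp (N : ℕ) : (swapOp N).trace = N := by
  simp only [trace, diag_apply, swapOp, Fintype.sum_prod_type]
  have : ∀ i j : Fin N, (i = j ∧ j = i) ↔ i = j := fun i j => ⟨And.left, fun h => ⟨h, h.symm⟩⟩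
  simp [this]

theorem swapOp_mul_apply (N : ℕ) (R : Matrix (Fin N × Fin N) (Fin N × Fin N) ℂ)
    (p q : Fin N × Fin N) : (swapOp N * R) p q = R p.swap q := by
  obtain ⟨i, j⟩ := p
  simp [mul_apply, swapOp, Fintype.sum_prod_type, ite_and]

theorem swapOp_mul_self (N : ℕ) : swapOp N * swapOp N = 1 := by
  ext p q
  rw [swapOp_mul_apply]
  simp [swapOp, one_apply, Prod.ext_iff, and_comm]

theorem trace_swapOp_mul (N : ℕ) (R : Matrix (Fin N × Fin N) (Fin N × Fin N) ℂ) :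
    (swapOp N * R).trace = ∑ p, R p p.swap := by
  simp only [trace, diag_apply, swapOp_mul_apply]
  exact ((Equiv.prodComm (Fin N) (Fin N)).sum_comp fun p => R p p.swap)

theorem trace_Pplus (N : ℕ) : (Pplus N).trace = (N : ℂ) * (N + 1) / 2 := by
  simp only [Pplus, trace_smul, trace_add, trace_one, trace_swapOp, Fintype.card_prod,
    Fintype.card_fin, smul_eq_mul]
  push_cast
  ring

theorem trace_Pminus (N : ℕ) : (Pminus N).trace = (N : ℂ) * (N - 1) / 2 := by
  simp only [Pminus, trace_smul, trace_sub, trace_one, trace_swapOp, Fintype.card_prod,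
    Fintype.card_fin, smul_eq_mul]
  push_cast
  ring

theorem trace_attachAux (N d : ℕ) {v : Fin d → ℂ} (hv : ∑ s, ‖v s‖ ^ 2 = 1)
    (R : Matrix (Fin N × Fin N) (Fin N × Fin N) ℂ) : (attachAux N d v R).trace = R.trace := by
  have hv' : ∑ s, v s * starRingEnd ℂ (v s) = 1 := by
    simp only [Complex.mul_conj']
    exact_mod_cast hv
  have hterm : ∀ i j : Fin N, ∑ s, ∑ t, R (i, j) (i, j) *
      (v s * v t * starRingEnd ℂ (v s) * starRingEnd ℂ (v t)) = R (i, j) (i, j) := by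
    intro i j
    calc _ = R (i, j) (i, j) * ((∑ s, v s * starRingEnd ℂ (v s)) *
          ∑ t, v t * starRingEnd ℂ (v t)) := by
          rw [Finset.sum_mul_sum]
          simp only [Finset.mul_sum]
          refine Finset.sum_congr rfl fun s _ => Finset.sum_congr rfl fun t _ => ?_
          ring
      _ = _ := by rw [hv', one_mul, mul_one]
  simp only [trace, diag_apply, attachAux, Fintype.sum_prod_type]
  refine Finset.sum_congr rfl fun i _ => ?_
  rw [Finset.sum_comm]
  exact Finset.sum_congr rfl fun j _ => hterm i j

theorem sum_attachAux_swap (N d : ℕ) {v : Fin d → ℂ} (hv : ∑ s, ‖v s‖ ^ 2 = 1)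
    (R : Matrix (Fin N × Fin N) (Fin N × Fin N) ℂ) :
    ∑ p, attachAux N d v R p p.swap = ∑ p, R p p.swap := by
  have h := trace_attachAux N d hv (R.submatrix id Prod.swap)
  simp only [trace, diag_apply, submatrix_apply, id] at h
  rw [← h]
  refine Finset.sum_congr rfl fun p _ => ?_
  simp only [attachAux, submatrix_apply, id, Prod.fst_swap, Prod.snd_swap, Prod.swap_prod_mk]
  ring

/-- The doubled channel in terms of the identity and the swap. -/
theorem doubledMPSChannel_eq (N d : ℕ) (hN : 2 ≤ N) (hd : 0 < d)
    (μ : Measure (Matrix.unitaryGroup (Fin N × Fin d) ℂ))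
    [μ.IsMulLeftInvariant] [IsProbabilityMeasure μ]
    (v : Fin d → ℂ) (hv : ∑ s, ‖v s‖ ^ 2 = 1)
    (R : Matrix (Fin N × Fin N) (Fin N × Fin N) ℂ) :
    doubledMPSChannel N d μ v R =
      (d * (N * d * R.trace - (swapOp N * R).trace) / (N * ((N * d - 1) * (N * d + 1))) : ℂ) •
          (1 : Matrix (Fin N × Fin N) (Fin N × Fin N) ℂ)
        + ((N * d * (swapOp N * R).trace - R.trace) / (N * ((N * d - 1) * (N * d + 1))) : ℂ) •
          swapOp N := by
  have hN0 : (N : ℂ) ≠ 0 := by norm_cast; omega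
  have hd0 : (d : ℂ) ≠ 0 := by norm_cast; omega
  have hDp : (N : ℂ) * d + 1 ≠ 0 := by norm_cast
  have hND : 1 < N * d := by nlinarith
  have hDm : (N : ℂ) * d - 1 ≠ 0 := sub_ne_zero.mpr (by norm_cast; omega)
  ext p q
  have hsum : doubledMPSChannel N d μ v R p q = ∑ s₁ : Fin d, ∑ s₂ : Fin d,
      haarTwirl μ (attachAux N d v R) ((p.1, s₁), (p.2, s₂)) ((q.1, s₁), (q.2, s₂)) := by
    have hint := integrable_conj_kronecker_self μ (attachAux N d v R)
    simp only [doubledMPSChannel, haarTwirl]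
    rw [integral_finsetSum _ fun s₁ _ => integrable_finsetSum _ fun s₂ _ => hint _ _]
    exact Finset.sum_congr rfl fun s₁ _ => integral_finsetSum _ fun s₂ _ => hint _ _
  have hentry := haarTwirl_apply μ (attachAux N d v R)
  rw [trace_attachAux N d hv, sum_attachAux_swap N d hv, ← trace_swapOp_mul] at hentry
  simp only [Fintype.card_prod, Fintype.card_fin, Nat.cast_mul] at hentry
  generalize R.trace = t at hentry ⊢
  generalize (swapOp N * R).trace = s at hentry ⊢
  have hfac : ((N : ℂ) * d) * ((N * d) ^ 2 - 1) = N * d * ((N * d - 1) * (N * d + 1)) := by ring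
  have hne : ((N : ℂ) * d) * ((N * d) ^ 2 - 1) ≠ 0 := by
    rw [hfac]
    positivity
  have htotal : ((N : ℂ) * d) * ((N * d) ^ 2 - 1) * doubledMPSChannel N d μ v R p q =
      (N * d * t - s) * (d ^ 2 * (1 : Matrix (Fin N × Fin N) (Fin N × Fin N) ℂ) p q)
        + (N * d * s - t) * (d * swapOp N p q) := by
    rw [hsum]
    simp only [Finset.mul_sum, hentry, Finset.sum_add_distrib]
    simp only [← Finset.mul_sum]
    congr 2
    · simp [one_apply, Prod.ext_iff, sq]
    · simp only [swapOp, Prod.ext_iff]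
      by_cases h : p.1 = q.2 ∧ p.2 = q.1
      · have hiff : ∀ x y : Fin d, (x = y ∧ y = x) ↔ x = y :=
          fun x y => ⟨And.left, fun h => ⟨h, h.symm⟩⟩
        simp [h.1, h.2, hiff]
      · rw [if_neg h, mul_zero]
        exact Finset.sum_eq_zero fun x _ => Finset.sum_eq_zero fun y _ =>
          if_neg fun h' => h ⟨h'.2.1, h'.1.1⟩
  apply mul_left_cancel₀ hne
  rw [htotal, hfac]
  simp only [Matrix.add_apply, Matrix.smul_apply, smul_eq_mul]
  field_simp

/-- Spectral decomposition of the doubled MPS channel: with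
`η = (1 − 1/N²)/(d − 1/(N²d))`, `P'± = P±/Tr P±`,
`r₁ = (1/(2(N²d+1)))[(Nd+1)(N+1)P'₊ + (Nd−1)(N−1)P'₋]`,
`ℓ₂ = (1/(2(N²d+1)))[(Nd−1)(N−1)P₊ − (Nd+1)(N+1)P₋]`, `r₂ = P'₊ − P'₋`,
one has `(ℰ⁽²⁾)ⁿ(R) = Tr(R) r₁ + ηⁿ Tr(ℓ₂ R) r₂` for all `n ≥ 1`; in particular
`ℰ⁽²⁾(r₁) = r₁` and `ℰ⁽²⁾(r₂) = η r₂`. -/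
theorem doubled_mps_channel_spectral (N d : ℕ) (hN : 2 ≤ N) (hd : 0 < d)
    (μ : Measure (Matrix.unitaryGroup (Fin N × Fin d) ℂ))
    [μ.IsHaarMeasure] [IsProbabilityMeasure μ]
    (v : Fin d → ℂ) (hv : ∑ s, ‖v s‖ ^ 2 = 1) :
    let η : ℂ := (1 - 1 / (N : ℂ) ^ 2) / ((d : ℂ) - 1 / ((N : ℂ) ^ 2 * (d : ℂ)))
    let P'p := (1 / (Pplus N).trace) • Pplus N
    let P'm := (1 / (Pminus N).trace) • Pminus N
    let r₁ := (1 / (2 * ((N : ℂ) ^ 2 * (d : ℂ) + 1))) •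
        ((((N : ℂ) * d + 1) * ((N : ℂ) + 1)) • P'p + (((N : ℂ) * d - 1) * ((N : ℂ) - 1)) • P'm)
    let ℓ₂ := (1 / (2 * ((N : ℂ) ^ 2 * (d : ℂ) + 1))) •
        ((((N : ℂ) * d - 1) * ((N : ℂ) - 1)) • Pplus N
          - (((N : ℂ) * d + 1) * ((N : ℂ) + 1)) • Pminus N)
    let r₂ := P'p - P'm
    (∀ n : ℕ, 1 ≤ n → ∀ R : Matrix (Fin N × Fin N) (Fin N × Fin N) ℂ,
        (doubledMPSChannel N d μ v)^[n] R = R.trace • r₁ + (η ^ n * (ℓ₂ * R).trace) • r₂)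
      ∧ doubledMPSChannel N d μ v r₁ = r₁
      ∧ doubledMPSChannel N d μ v r₂ = η • r₂ := by
  intro η P'p P'm r₁ ℓ₂ r₂
  have hN0 : (N : ℂ) ≠ 0 := by norm_cast; omega
  have hd0 : (d : ℂ) ≠ 0 := by norm_cast; omega
  have hNp : (N : ℂ) + 1 ≠ 0 := by norm_cast
  have hNm : (N : ℂ) - 1 ≠ 0 := sub_ne_zero.mpr (by norm_cast; omega)
  have hDp : (N : ℂ) * d + 1 ≠ 0 := by norm_cast
  have hND : 1 < N * d := by nlinarith
  have hDm : (N : ℂ) * d - 1 ≠ 0 := sub_ne_zero.mpr (by norm_cast; omega)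
  have hK : (N : ℂ) ^ 2 * d + 1 ≠ 0 := by norm_cast
  have hη : η = d * (((N : ℂ) - 1) * (N + 1)) / ((N * d - 1) * (N * d + 1)) := by
    have h : (d : ℂ) - 1 / ((N : ℂ) ^ 2 * d) = ((N * d - 1) * (N * d + 1)) / (N ^ 2 * d) := by
      field_simp
      ring
    simp only [η, h]
    field_simp
    ring
  have hP'p : P'p = (1 / (N * (N + 1)) : ℂ) • (1 + swapOp N) := by
    simp only [P'p]
    rw [trace_Pplus, Pplus, smul_smul]
    congr 1
    field_simp
  have hP'm : P'm = (1 / (N * (N - 1)) : ℂ) • (1 - swapOp N) := by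
    simp only [P'm]
    rw [trace_Pminus, Pminus, smul_smul]
    congr 1
    field_simp
  have hℓ : ∀ R, (ℓ₂ * R).trace = 1 / (2 * ((N : ℂ) ^ 2 * d + 1)) *
      ((N * d - 1) * (N - 1) * (1 / 2 * (R.trace + (swapOp N * R).trace))
        - (N * d + 1) * (N + 1) * (1 / 2 * (R.trace - (swapOp N * R).trace))) := by
    intro R
    simp only [ℓ₂, Pplus, Pminus, Matrix.smul_mul, Matrix.sub_mul, Matrix.add_mul, trace_smul,
      trace_sub, trace_add, Matrix.one_mul, smul_eq_mul]
  have hstep : ∀ R, doubledMPSChannel N d μ v R = R.trace • r₁ + (η * (ℓ₂ * R).trace) • r₂ := by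
    intro R
    rw [doubledMPSChannel_eq N d hN hd μ v hv, hℓ, hη]
    simp only [r₁, r₂, hP'p, hP'm]
    generalize R.trace = t
    generalize (swapOp N * R).trace = s
    have hDm' : (d : ℂ) * N - 1 ≠ 0 := by rwa [mul_comm]
    have hK' : (d : ℂ) * N ^ 2 + 1 ≠ 0 := by rwa [mul_comm]
    have hDp' : (d : ℂ) * N + 1 ≠ 0 := by rwa [mul_comm]
    match_scalars
    · field_simp
      ring
    · field_simp
      ring
  have htp : (1 + swapOp N).trace = (N : ℂ) * (N + 1) := by
    rw [trace_add, trace_one, trace_swapOp]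
    simp
    ring
  have htm : (1 - swapOp N).trace = (N : ℂ) * (N - 1) := by
    rw [trace_sub, trace_one, trace_swapOp]
    simp
    ring
  have hsp : (swapOp N * (1 + swapOp N)).trace = (N : ℂ) * (N + 1) := by
    rw [Matrix.mul_add, swapOp_mul_self, Matrix.mul_one, add_comm, htp]
  have hsm : (swapOp N * (1 - swapOp N)).trace = -((N : ℂ) * (N - 1)) := by
    rw [Matrix.mul_sub, swapOp_mul_self, Matrix.mul_one, ← neg_sub, trace_neg, htm]
  have ht₁ : r₁.trace = 1 := by
    simp only [r₁, hP'p, hP'm, trace_smul, trace_add, htp, htm, smul_eq_mul]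
    field_simp
    ring
  have ht₂ : r₂.trace = 0 := by
    simp only [r₂, hP'p, hP'm, trace_smul, trace_sub, htp, htm, smul_eq_mul]
    field_simp
    ring
  have hl₁ : (ℓ₂ * r₁).trace = 0 := by
    rw [hℓ, ht₁]
    simp only [r₁, hP'p, hP'm, Matrix.mul_smul, Matrix.mul_add, trace_smul, trace_add]
    simp only [← trace_add, ← Matrix.mul_add, hsp, hsm, smul_eq_mul]
    field_simp
    ring
  have hl₂ : (ℓ₂ * r₂).trace = 1 := by
    rw [hℓ, ht₂]
    simp only [r₂, hP'p, hP'm, Matrix.mul_smul, Matrix.mul_sub (swapOp N) (_ • _), trace_smul,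
      trace_sub (_ • _), hsp, hsm, smul_eq_mul]
    field_simp
    ring
  have hfix₁ : doubledMPSChannel N d μ v r₁ = r₁ := by
    rw [hstep, ht₁, hl₁]
    simp
  have hfix₂ : doubledMPSChannel N d μ v r₂ = η • r₂ := by
    rw [hstep, ht₂, hl₂]
    simp
  refine ⟨fun n hn R => ?_, hfix₁, hfix₂⟩
  induction n, hn using Nat.le_induction with
  | base => simpa using hstep R
  | succ n _ ih =>
    rw [Function.iterate_succ_apply', ih, hstep]
    simp only [Matrix.mul_add, Matrix.mul_smul, trace_add, trace_smul, ht₁, ht₂, hl₁, hl₂,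
      smul_eq_mul, mul_one, mul_zero, add_zero, zero_add]
    congr 2
    ring
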